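/- Suppose y₀ satisfies the Euler–Lagrange equation f_y(x, y₀(x), y₀'(x)) − (d/dx)[f_z(x, y₀(x), y₀'(x))] = 0 for all x ∈ [a,b]. If p > 0, q < 0, and b − a < (π/4)·√(p/|q|), then there exists ε > 0 such that for every y ∈ C¹[a,b] with y(a)=y₀(a), y(b)=y₀(b) and max_{x∈[a,b]} max(|y(x)−y₀(x)|, |y'(x)−y₀'(x)|) < ε one has Φ(y) − Φ(y₀) ≥ ((π²·p − 16(b−a)²·|q|) / (2(π² + 16(b−a)²)))·‖y − y₀‖²_{H¹[a,b]}. -/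

import Mathlib

open Set MeasureTheory intervalIntegral

/-- Partial derivative of `f` with respect to the second argument `y`. -/
noncomputable def fy (f : ℝ → ℝ → ℝ → ℝ) (x y z : ℝ) : ℝ :=
  deriv (fun u => f x u z) y

/-- Partial derivative of `f` with respect to the third argument `z`. -/
noncomputable def fz (f : ℝ → ℝ → ℝ → ℝ) (x y z : ℝ) : ℝ :=
  deriv (fun u => f x y u) z

/-- Second partial derivative `f_{yy}`. -/
noncomputable def fyy (f : ℝ → ℝ → ℝ → ℝ) (x y z : ℝ) : ℝ :=
  deriv (fun u => fy f x u z) y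

/-- Mixed second partial derivative `f_{yz}`. -/
noncomputable def fyz (f : ℝ → ℝ → ℝ → ℝ) (x y z : ℝ) : ℝ :=
  deriv (fun u => fz f x u z) y

/-- Second partial derivative `f_{zz}`. -/
noncomputable def fzz (f : ℝ → ℝ → ℝ → ℝ) (x y z : ℝ) : ℝ :=
  deriv (fun u => fz f x y u) z

/-- The Euler–Lagrange variational functional `Φ(y) = ∫_a^b f(x, y, y') dx`. -/
noncomputable def Phi (f : ℝ → ℝ → ℝ → ℝ) (a b : ℝ) (y : ℝ → ℝ) : ℝ :=
  ∫ x in a..b, f x (y x) (deriv y x)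

/-- The square of the Sobolev `H¹[a,b]` norm of `y`. -/
noncomputable def H1normSq (a b : ℝ) (y : ℝ → ℝ) : ℝ :=
  ∫ x in a..b, ((y x) ^ 2 + (deriv y x) ^ 2)

open Filter Topology

section PartialDerivatives

/-- Directional derivative of a function on `ℝ × ℝ × ℝ`. -/
noncomputable def dirDeriv (G : ℝ × ℝ × ℝ → ℝ) (v p : ℝ × ℝ × ℝ) : ℝ :=
  fderiv ℝ G p v

theorem deriv_snd_eq_dirDeriv {G : ℝ × ℝ × ℝ → ℝ} (hG : Differentiable ℝ G) (x y z : ℝ) :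
    deriv (fun u => G (x, u, z)) y = dirDeriv G (0, 1, 0) (x, y, z) := by
  have hline : HasDerivAt (fun u : ℝ => ((x, u, z) : ℝ × ℝ × ℝ)) (0, 1, 0) y :=
    (hasDerivAt_const y x).prodMk ((hasDerivAt_id y).prodMk (hasDerivAt_const y z))
  exact ((hG (x, y, z)).hasFDerivAt.comp_hasDerivAt y hline).deriv

theorem deriv_thd_eq_dirDeriv {G : ℝ × ℝ × ℝ → ℝ} (hG : Differentiable ℝ G) (x y z : ℝ) :
    deriv (fun u => G (x, y, u)) z = dirDeriv G (0, 0, 1) (x, y, z) := by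
  have hline : HasDerivAt (fun u : ℝ => ((x, y, u) : ℝ × ℝ × ℝ)) (0, 0, 1) z :=
    (hasDerivAt_const z x).prodMk ((hasDerivAt_const z y).prodMk (hasDerivAt_id z))
  exact ((hG (x, y, z)).hasFDerivAt.comp_hasDerivAt z hline).deriv

theorem hasDerivAt_along_segment {G : ℝ × ℝ × ℝ → ℝ} (hG : Differentiable ℝ G)
    (x y z u v t : ℝ) :
    HasDerivAt (fun s => G (x, y + s * u, z + s * v))
      (u * dirDeriv G (0, 1, 0) (x, y + t * u, z + t * v)
        + v * dirDeriv G (0, 0, 1) (x, y + t * u, z + t * v)) t := by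
  have hline : HasDerivAt (fun s : ℝ => ((x, y + s * u, z + s * v) : ℝ × ℝ × ℝ)) (0, u, v) t :=
    (hasDerivAt_const t x).prodMk
      (((hasDerivAt_mul_const u).const_add y).prodMk ((hasDerivAt_mul_const v).const_add z))
  have h := (hG (x, y + t * u, z + t * v)).hasFDerivAt.comp_hasDerivAt t hline
  have hsplit : ((0, u, v) : ℝ × ℝ × ℝ) = u • (0, 1, 0) + v • (0, 0, 1) := by simp
  rw [hsplit, map_add, map_smul, map_smul] at h
  exact h

theorem contDiff_dirDeriv {G : ℝ × ℝ × ℝ → ℝ} {m n : WithTop ℕ∞} (hG : ContDiff ℝ n G)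
    (hmn : m + 1 ≤ n) (v : ℝ × ℝ × ℝ) : ContDiff ℝ m (dirDeriv G v) :=
  (hG.fderiv_right hmn).clm_apply contDiff_const

theorem dirDeriv_comm {G : ℝ × ℝ × ℝ → ℝ} (hG : ContDiff ℝ 2 G) (v w p : ℝ × ℝ × ℝ) :
    dirDeriv (dirDeriv G v) w p = dirDeriv (dirDeriv G w) v p := by
  have hd : Differentiable ℝ (fderiv ℝ G) :=
    (hG.fderiv_right (m := 1) (by norm_num)).differentiable (by norm_num)
  have key (v w : ℝ × ℝ × ℝ) : dirDeriv (dirDeriv G v) w p = fderiv ℝ (fderiv ℝ G) p w v := by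
    have h := (hd p).hasFDerivAt.clm_apply (hasFDerivAt_const v p)
    change fderiv ℝ (fun q => fderiv ℝ G q v) p w = _
    rw [h.fderiv]
    simp
  rw [key, key]
  exact (hG.contDiffAt.isSymmSndFDerivAt (by simp)) w v

end PartialDerivatives

theorem add_deriv_add_half_le_of_le_deriv2 {g g' g'' : ℝ → ℝ} {c : ℝ}
    (hg : ∀ t, HasDerivAt g (g' t) t) (hg' : ∀ t, HasDerivAt g' (g'' t) t)
    (hc : ∀ t ∈ Icc (0 : ℝ) 1, c ≤ g'' t) : g 0 + g' 0 + c / 2 ≤ g 1 := by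
  have h1 : ∀ t ∈ Icc (0 : ℝ) 1, g' 0 + c * t ≤ g' t := by
    have hd (t : ℝ) : HasDerivAt (fun s => g' s - c * s) (g'' t - c) t := by
      have := (hg' t).sub ((hasDerivAt_id t).const_mul c)
      rwa [mul_one] at this
    have hm : MonotoneOn (fun s => g' s - c * s) (Icc 0 1) := by
      refine monotoneOn_of_deriv_nonneg (convex_Icc 0 1)
        (fun t _ => (hd t).continuousAt.continuousWithinAt)
        (fun t _ => (hd t).differentiableAt.differentiableWithinAt) fun t ht => ?_
      rw [(hd t).deriv]
      linarith [hc t (interior_subset ht)]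
    intro t ht
    have := hm (left_mem_Icc.2 zero_le_one) ht ht.1
    linarith
  have hd (t : ℝ) : HasDerivAt (fun s => g s - (g' 0 * s + c / 2 * s ^ 2))
      (g' t - (g' 0 + c * t)) t := by
    refine ((hg t).sub (((hasDerivAt_id t).const_mul (g' 0)).add
      (((hasDerivAt_id t).pow 2).const_mul (c / 2)))).congr_deriv ?_
    norm_num
    ring
  have hm : MonotoneOn (fun s => g s - (g' 0 * s + c / 2 * s ^ 2)) (Icc 0 1) := by
    refine monotoneOn_of_deriv_nonneg (convex_Icc 0 1)
      (fun t _ => (hd t).continuousAt.continuousWithinAt)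
      (fun t _ => (hd t).differentiableAt.differentiableWithinAt) fun t ht => ?_
    rw [(hd t).deriv]
    linarith [h1 t (interior_subset ht)]
  have := hm (left_mem_Icc.2 zero_le_one) (right_mem_Icc.2 zero_le_one) zero_le_one
  linarith

theorem integral_sq_le_of_left_eq_zero {a b : ℝ} (hab : a < b) {h : ℝ → ℝ}
    (hh : ContDiff ℝ 1 h) (ha : h a = 0) :
    ∫ x in a..b, h x ^ 2 ≤ (b - a) ^ 2 * ∫ x in a..b, deriv h x ^ 2 := by
  have hL : 0 < b - a := sub_pos.2 hab
  have hc : Continuous h := hh.continuous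
  have hc' : Continuous (deriv h) := hh.continuous_deriv le_rfl
  have hpt : ∀ x ∈ Icc a b, h x ^ 2 ≤ (b - a) * ∫ s in a..b, deriv h s ^ 2 := by
    intro x hx
    set m := h x / (b - a) with hm
    have hmL : h x = m * (b - a) := by rw [hm]; field_simp
    have hftc : ∫ s in a..x, deriv h s = h x := by
      rw [integral_deriv_eq_sub (fun t _ => hh.differentiable (by norm_num) t)
        (hc'.intervalIntegrable _ _), ha, sub_zero]
    have hnn : 0 ≤ ∫ s in a..x, (deriv h s - m) ^ 2 :=
      intervalIntegral.integral_nonneg hx.1 fun s _ => sq_nonneg _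
    have hexp : ∫ s in a..x, (deriv h s - m) ^ 2
        = (∫ s in a..x, deriv h s ^ 2) - 2 * m * h x + m ^ 2 * (x - a) := by
      have : (fun s => (deriv h s - m) ^ 2)
          = fun s => deriv h s ^ 2 - 2 * m * deriv h s + m ^ 2 := by ext s; ring
      rw [this, intervalIntegral.integral_add, intervalIntegral.integral_sub, intervalIntegral.integral_const_mul, hftc, intervalIntegral.integral_const, smul_eq_mul]
      · ring
      all_goals exact Continuous.intervalIntegrable (by fun_prop) _ _
    have hmono : ∫ s in a..x, deriv h s ^ 2 ≤ ∫ s in a..b, deriv h s ^ 2 :=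
      intervalIntegral.integral_mono_interval le_rfl hx.1 hx.2 (Eventually.of_forall fun s => sq_nonneg _)
        ((hc'.pow 2).intervalIntegrable _ _)
    have hmx : m ^ 2 * (x - a) ≤ m ^ 2 * (b - a) :=
      mul_le_mul_of_nonneg_left (by linarith [hx.2]) (sq_nonneg m)
    have hlow : m ^ 2 * (b - a) ≤ ∫ s in a..b, deriv h s ^ 2 := by
      rw [hexp, hmL] at hnn
      nlinarith
    rw [hmL]
    nlinarith [mul_le_mul_of_nonneg_left hlow hL.le]
  calc ∫ x in a..b, h x ^ 2 ≤ ∫ _ in a..b, (b - a) * ∫ s in a..b, deriv h s ^ 2 :=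
        intervalIntegral.integral_mono_on hab.le ((hc.pow 2).intervalIntegrable _ _)
          (continuous_const.intervalIntegrable _ _) hpt
    _ = (b - a) ^ 2 * ∫ x in a..b, deriv h x ^ 2 := by
        rw [intervalIntegral.integral_const, smul_eq_mul]
        ring

/-- Near a compact piece of a graph, a continuous function varies uniformly little. -/
theorem exists_uniform_tube {D : ℝ × ℝ × ℝ → ℝ} (hD : Continuous D) {y z : ℝ → ℝ}
    (hy : Continuous y) (hz : Continuous z) (a b : ℝ) {δ : ℝ} (hδ : 0 < δ) :
    ∃ ε > 0, ∀ x ∈ Icc a b, ∀ u v : ℝ, |u| < ε → |v| < ε →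
      |D (x, y x + u, z x + v) - D (x, y x, z x)| < δ := by
  have hE : Continuous fun r : (ℝ × ℝ) × ℝ =>
      |D (r.2, y r.2 + r.1.1, z r.2 + r.1.2) - D (r.2, y r.2, z r.2)| := by fun_prop
  have hev : ∀ᶠ w : ℝ × ℝ in 𝓝 (0, 0), ∀ x ∈ Icc a b,
      |D (x, y x + w.1, z x + w.2) - D (x, y x, z x)| < δ := by
    refine isCompact_Icc.eventually_forall_of_forall_eventually fun x _ => ?_
    exact hE.continuousAt.eventually_lt continuousAt_const (by simpa using hδ)
  obtain ⟨ε, hε, hball⟩ := Metric.eventually_nhds_iff.1 hev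
  refine ⟨ε, hε, fun x hx u v hu hv => hball (y := (u, v)) ?_ x hx⟩
  simpa [Prod.dist_eq] using ⟨hu, hv⟩

section SecondOrderExpansion

variable {f : ℝ → ℝ → ℝ → ℝ}

theorem fy_eq_dirDeriv
    (hf : ContDiff ℝ 2 (fun pt : ℝ × ℝ × ℝ => f pt.1 pt.2.1 pt.2.2)) (x y z : ℝ) :
    fy f x y z
      = dirDeriv (fun pt : ℝ × ℝ × ℝ => f pt.1 pt.2.1 pt.2.2) (0, 1, 0) (x, y, z) :=
  deriv_snd_eq_dirDeriv (hf.differentiable (by norm_num)) x y z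

theorem fz_eq_dirDeriv
    (hf : ContDiff ℝ 2 (fun pt : ℝ × ℝ × ℝ => f pt.1 pt.2.1 pt.2.2)) (x y z : ℝ) :
    fz f x y z
      = dirDeriv (fun pt : ℝ × ℝ × ℝ => f pt.1 pt.2.1 pt.2.2) (0, 0, 1) (x, y, z) :=
  deriv_thd_eq_dirDeriv (hf.differentiable (by norm_num)) x y z

theorem contDiff_fy
    (hf : ContDiff ℝ 2 (fun pt : ℝ × ℝ × ℝ => f pt.1 pt.2.1 pt.2.2)) :
    ContDiff ℝ 1 (fun pt : ℝ × ℝ × ℝ => fy f pt.1 pt.2.1 pt.2.2) := by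
  simp only [fy_eq_dirDeriv hf]
  exact contDiff_dirDeriv hf (by norm_num) _

theorem contDiff_fz
    (hf : ContDiff ℝ 2 (fun pt : ℝ × ℝ × ℝ => f pt.1 pt.2.1 pt.2.2)) :
    ContDiff ℝ 1 (fun pt : ℝ × ℝ × ℝ => fz f pt.1 pt.2.1 pt.2.2) := by
  simp only [fz_eq_dirDeriv hf]
  exact contDiff_dirDeriv hf (by norm_num) _

theorem fyy_eq_dirDeriv
    (hf : ContDiff ℝ 2 (fun pt : ℝ × ℝ × ℝ => f pt.1 pt.2.1 pt.2.2)) (x y z : ℝ) :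
    fyy f x y z
      = dirDeriv (fun pt : ℝ × ℝ × ℝ => fy f pt.1 pt.2.1 pt.2.2) (0, 1, 0) (x, y, z) :=
  deriv_snd_eq_dirDeriv ((contDiff_fy hf).differentiable (by norm_num)) x y z

theorem fyz_eq_dirDeriv
    (hf : ContDiff ℝ 2 (fun pt : ℝ × ℝ × ℝ => f pt.1 pt.2.1 pt.2.2)) (x y z : ℝ) :
    fyz f x y z
      = dirDeriv (fun pt : ℝ × ℝ × ℝ => fz f pt.1 pt.2.1 pt.2.2) (0, 1, 0) (x, y, z) :=
  deriv_snd_eq_dirDeriv ((contDiff_fz hf).differentiable (by norm_num)) x y z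

theorem fzz_eq_dirDeriv
    (hf : ContDiff ℝ 2 (fun pt : ℝ × ℝ × ℝ => f pt.1 pt.2.1 pt.2.2)) (x y z : ℝ) :
    fzz f x y z
      = dirDeriv (fun pt : ℝ × ℝ × ℝ => fz f pt.1 pt.2.1 pt.2.2) (0, 0, 1) (x, y, z) :=
  deriv_thd_eq_dirDeriv ((contDiff_fz hf).differentiable (by norm_num)) x y z

theorem fyz_eq_dirDeriv_fy
    (hf : ContDiff ℝ 2 (fun pt : ℝ × ℝ × ℝ => f pt.1 pt.2.1 pt.2.2)) (x y z : ℝ) :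
    fyz f x y z
      = dirDeriv (fun pt : ℝ × ℝ × ℝ => fy f pt.1 pt.2.1 pt.2.2) (0, 0, 1) (x, y, z) := by
  rw [fyz_eq_dirDeriv hf]
  simp only [fz_eq_dirDeriv hf, fy_eq_dirDeriv hf]
  exact dirDeriv_comm hf _ _ _

theorem continuous_fyy
    (hf : ContDiff ℝ 2 (fun pt : ℝ × ℝ × ℝ => f pt.1 pt.2.1 pt.2.2)) :
    Continuous (fun pt : ℝ × ℝ × ℝ => fyy f pt.1 pt.2.1 pt.2.2) := by
  simp only [fyy_eq_dirDeriv hf]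
  exact (contDiff_dirDeriv (m := 0) (contDiff_fy hf) (by norm_num) _).continuous

theorem continuous_fyz
    (hf : ContDiff ℝ 2 (fun pt : ℝ × ℝ × ℝ => f pt.1 pt.2.1 pt.2.2)) :
    Continuous (fun pt : ℝ × ℝ × ℝ => fyz f pt.1 pt.2.1 pt.2.2) := by
  simp only [fyz_eq_dirDeriv hf]
  exact (contDiff_dirDeriv (m := 0) (contDiff_fz hf) (by norm_num) _).continuous

theorem continuous_fzz
    (hf : ContDiff ℝ 2 (fun pt : ℝ × ℝ × ℝ => f pt.1 pt.2.1 pt.2.2)) :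
    Continuous (fun pt : ℝ × ℝ × ℝ => fzz f pt.1 pt.2.1 pt.2.2) := by
  simp only [fzz_eq_dirDeriv hf]
  exact (contDiff_dirDeriv (m := 0) (contDiff_fz hf) (by norm_num) _).continuous

/-- Second order lower Taylor bound when the second partials vary by less than `δ`. -/
theorem taylor_lower_bound
    (hf : ContDiff ℝ 2 (fun pt : ℝ × ℝ × ℝ => f pt.1 pt.2.1 pt.2.2))
    {x y z u v δ : ℝ}
    (hyy : ∀ t ∈ Icc (0 : ℝ) 1, |fyy f x (y + t * u) (z + t * v) - fyy f x y z| < δ)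
    (hyz : ∀ t ∈ Icc (0 : ℝ) 1, |fyz f x (y + t * u) (z + t * v) - fyz f x y z| < δ)
    (hzz : ∀ t ∈ Icc (0 : ℝ) 1, |fzz f x (y + t * u) (z + t * v) - fzz f x y z| < δ) :
    f x y z + (u * fy f x y z + v * fz f x y z)
        + (fyy f x y z * u ^ 2 + 2 * fyz f x y z * (u * v) + fzz f x y z * v ^ 2) / 2
        - δ * (u ^ 2 + v ^ 2)
      ≤ f x (y + u) (z + v) := by
  have h1 (t : ℝ) := hasDerivAt_along_segment (hf.differentiable (by norm_num)) x y z u v t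
  have h2 (t : ℝ) := hasDerivAt_along_segment
    ((contDiff_fy hf).differentiable (by norm_num)) x y z u v t
  have h3 (t : ℝ) := hasDerivAt_along_segment
    ((contDiff_fz hf).differentiable (by norm_num)) x y z u v t
  simp only [← fy_eq_dirDeriv hf, ← fz_eq_dirDeriv hf] at h1
  simp only [← fyy_eq_dirDeriv hf, ← fyz_eq_dirDeriv_fy hf] at h2
  simp only [← fyz_eq_dirDeriv hf, ← fzz_eq_dirDeriv hf] at h3
  have key := add_deriv_add_half_le_of_le_deriv2
    (c := fyy f x y z * u ^ 2 + 2 * fyz f x y z * (u * v) + fzz f x y z * v ^ 2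
      - 2 * δ * (u ^ 2 + v ^ 2)) h1
    (fun t => ((h2 t).const_mul u).add ((h3 t).const_mul v)) fun t ht => ?_
  · simp only [zero_mul, add_zero, one_mul] at key
    linarith
  · have hA := abs_lt.1 (hyy t ht)
    have hB := abs_lt.1 (hyz t ht)
    have hC := abs_lt.1 (hzz t ht)
    have eA := mul_nonneg (sub_nonneg.2 hA.1.le) (sq_nonneg u)
    have eC := mul_nonneg (sub_nonneg.2 hC.1.le) (sq_nonneg v)
    have eB1 := mul_nonneg (sub_nonneg.2 hB.1.le) (sq_nonneg (u + v))
    have eB2 := mul_nonneg (sub_nonneg.2 hB.2.le) (sq_nonneg (u - v))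
    nlinarith

end SecondOrderExpansion

theorem quadratic_coercivity_gap {p q L : ℝ} (hL : 0 < L) (hp : 0 < p) (hq : q < 0) :
    ∃ δ > 0, ∀ A B : ℝ, B ≤ L ^ 2 * A →
      (Real.pi ^ 2 * p - 16 * L ^ 2 * |q|) / (2 * (Real.pi ^ 2 + 16 * L ^ 2)) * (B + A)
        ≤ (q * B + p * A) / 2 - δ * (B + A) := by
  have hpi : Real.pi ^ 2 < 16 := by nlinarith [Real.pi_pos, Real.pi_lt_four]
  have hpi0 : 0 < Real.pi ^ 2 := pow_pos Real.pi_pos 2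
  have hL2 : 0 < L ^ 2 := pow_pos hL 2
  rw [abs_of_neg hq]
  refine ⟨(p + q * L ^ 2) / (2 * (1 + L ^ 2))
    - (Real.pi ^ 2 * p - 16 * L ^ 2 * -q) / (2 * (Real.pi ^ 2 + 16 * L ^ 2)), ?_, ?_⟩
  · rw [gt_iff_lt, sub_pos, div_lt_div_iff₀ (by positivity) (by positivity)]
    have : 0 < (16 - Real.pi ^ 2) * L ^ 2 * (p - q) :=
      mul_pos (mul_pos (by linarith) hL2) (by linarith)
    linarith
  · intro A B hAB
    have hkey : (p + q * L ^ 2) / (2 * (1 + L ^ 2)) * (B + A) ≤ (q * B + p * A) / 2 := by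
      rw [div_mul_eq_mul_div, div_le_div_iff₀ (by positivity) (by positivity)]
      have : 0 ≤ (p - q) * (L ^ 2 * A - B) := mul_nonneg (by linarith) (by linarith)
      linarith
    rw [sub_mul]
    linarith

theorem statement10
    (a b : ℝ) (hab : a < b)
    (f : ℝ → ℝ → ℝ → ℝ)
    (hf : ContDiff ℝ 2 (fun pt : ℝ × ℝ × ℝ => f pt.1 pt.2.1 pt.2.2))
    (hfyz : ContDiff ℝ 1 (fun pt : ℝ × ℝ × ℝ => fyz f pt.1 pt.2.1 pt.2.2))
    (y₀ : ℝ → ℝ) (hy₀ : ContDiff ℝ 2 y₀)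
    (hEL : ∀ x ∈ Set.Icc a b,
      fy f x (y₀ x) (deriv y₀ x) - deriv (fun t => fz f t (y₀ t) (deriv y₀ t)) x = 0)
    (p q : ℝ)
    (hp : IsLeast ((fun x => fzz f x (y₀ x) (deriv y₀ x)) '' Set.Icc a b) p)
    (hq : IsLeast ((fun x => fyy f x (y₀ x) (deriv y₀ x)
            - deriv (fun t => fyz f t (y₀ t) (deriv y₀ t)) x) '' Set.Icc a b) q)
    (hppos : 0 < p) (hqneg : q < 0)
    (hlen : b - a < Real.pi / 4 * Real.sqrt (p / |q|)) :
    ∃ ε > 0, ∀ y : ℝ → ℝ, ContDiff ℝ 1 y → y a = y₀ a → y b = y₀ b →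
      (∀ x ∈ Set.Icc a b, max |y x - y₀ x| |deriv y x - deriv y₀ x| < ε) →
      Phi f a b y - Phi f a b y₀ ≥
        (Real.pi ^ 2 * p - 16 * (b - a) ^ 2 * |q|) / (2 * (Real.pi ^ 2 + 16 * (b - a) ^ 2)) *
          H1normSq a b (fun x => y x - y₀ x) := by
  obtain ⟨δ, hδ, hgap⟩ := quadratic_coercivity_gap (sub_pos.2 hab) hppos hqneg
  have hy₀c : Continuous y₀ := hy₀.continuous
  have hy₀' : ContDiff ℝ 1 (deriv y₀) := by
    have : ContDiff ℝ (1 + 1) y₀ := by simpa [one_add_one_eq_two] using hy₀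
    exact (contDiff_succ_iff_deriv.1 this).2.2
  obtain ⟨ε₁, hε₁, H₁⟩ := exists_uniform_tube (continuous_fyy hf) hy₀c hy₀'.continuous a b hδ
  obtain ⟨ε₂, hε₂, H₂⟩ := exists_uniform_tube (continuous_fyz hf) hy₀c hy₀'.continuous a b hδ
  obtain ⟨ε₃, hε₃, H₃⟩ := exists_uniform_tube (continuous_fzz hf) hy₀c hy₀'.continuous a b hδ
  refine ⟨min ε₁ (min ε₂ ε₃), by positivity, fun y hy hya hyb hclose => ?_⟩
  have hy₀1 : ContDiff ℝ 1 y₀ := hy₀.of_le (by norm_num)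
  set h : ℝ → ℝ := fun x => y x - y₀ x with hh
  have hh1 : ContDiff ℝ 1 h := hy.sub hy₀1
  have hha : h a = 0 := by simp [hh, hya]
  have hhb : h b = 0 := by simp [hh, hyb]
  have hh' (x : ℝ) : deriv h x = deriv y x - deriv y₀ x :=
    deriv_fun_sub (hy.differentiable (by norm_num) x) (hy₀1.differentiable (by norm_num) x)
  have hcurve : ContDiff ℝ 1 fun x : ℝ => ((x, y₀ x, deriv y₀ x) : ℝ × ℝ × ℝ) :=
    contDiff_id.prodMk (hy₀1.prodMk hy₀')
  have hFz : ContDiff ℝ 1 fun x => fz f x (y₀ x) (deriv y₀ x) := (contDiff_fz hf).comp hcurve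
  have hFyz : ContDiff ℝ 1 fun x => fyz f x (y₀ x) (deriv y₀ x) := hfyz.comp hcurve
  set W : ℝ → ℝ := fun x =>
    fz f x (y₀ x) (deriv y₀ x) * h x + 1 / 2 * (fyz f x (y₀ x) (deriv y₀ x) * h x ^ 2) with hW
  have hW1 : ContDiff ℝ 1 W := (hFz.mul hh1).add (contDiff_const.mul (hFyz.mul (hh1.pow 2)))
  have hWd (x : ℝ) : deriv W x
      = (deriv (fun t => fz f t (y₀ t) (deriv y₀ t)) x * h x
          + fz f x (y₀ x) (deriv y₀ x) * deriv h x)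
        + 1 / 2 * (deriv (fun t => fyz f t (y₀ t) (deriv y₀ t)) x * h x ^ 2
          + fyz f x (y₀ x) (deriv y₀ x) * (2 * h x * deriv h x)) := by
    have d1 := (hFz.differentiable (by norm_num) x).hasDerivAt
    have d2 := (hFyz.differentiable (by norm_num) x).hasDerivAt
    have d3 := (hh1.differentiable (by norm_num) x).hasDerivAt
    have := ((d1.mul d3).add ((d2.mul (d3.pow 2)).const_mul (1 / 2))).deriv
    refine this.trans ?_
    simp
  have hh'c : Continuous (deriv h) := hh1.continuous_deriv le_rfl
  have hhc : Continuous h := hh1.continuous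
  have hW'c : Continuous (deriv W) := hW1.continuous_deriv le_rfl
  have hy'c : Continuous (deriv y) := hy.continuous_deriv le_rfl
  have hfy : Continuous fun x => f x (y x) (deriv y x) :=
    hf.continuous.comp (continuous_id.prodMk (hy.continuous.prodMk hy'c))
  have hfy₀ : Continuous fun x => f x (y₀ x) (deriv y₀ x) :=
    hf.continuous.comp hcurve.continuous
  have hpt : ∀ x ∈ Icc a b,
      deriv W x + ((q / 2 - δ) * h x ^ 2 + (p / 2 - δ) * deriv h x ^ 2)
        ≤ f x (y x) (deriv y x) - f x (y₀ x) (deriv y₀ x) := by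
    intro x hx
    have hsmall := hclose x hx
    rw [← hh', max_lt_iff] at hsmall
    have hscale {t r ε : ℝ} (ht : t ∈ Icc (0 : ℝ) 1) (hr : |r| < ε) : |t * r| < ε := by
      rw [abs_mul, abs_of_nonneg ht.1]
      exact (mul_le_of_le_one_left (abs_nonneg r) ht.2).trans_lt hr
    have hu := lt_min_iff.1 hsmall.1
    have hu' := lt_min_iff.1 hu.2
    have hv := lt_min_iff.1 hsmall.2
    have hv' := lt_min_iff.1 hv.2
    have hT := taylor_lower_bound hf (x := x) (y := y₀ x) (z := deriv y₀ x) (u := h x)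
      (v := deriv h x) (δ := δ)
      (fun t ht => H₁ x hx _ _ (hscale ht hu.1) (hscale ht hv.1))
      (fun t ht => H₂ x hx _ _ (hscale ht hu'.1) (hscale ht hv'.1))
      (fun t ht => H₃ x hx _ _ (hscale ht hu'.2) (hscale ht hv'.2))
    have e1 : y₀ x + h x = y x := by simp [hh]
    have e2 : deriv y₀ x + deriv h x = deriv y x := by rw [hh']; ring
    rw [e1, e2] at hT
    have hpx := mul_le_mul_of_nonneg_right (hp.2 (mem_image_of_mem _ hx))
      (sq_nonneg (deriv h x))
    have hqx := mul_le_mul_of_nonneg_right (hq.2 (mem_image_of_mem _ hx)) (sq_nonneg (h x))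
    have hELx := sub_eq_zero.1 (hEL x hx)
    rw [hWd, ← hELx]
    linarith
  have hWint : ∫ x in a..b, deriv W x = 0 := by
    rw [integral_deriv_eq_sub (fun x _ => hW1.differentiable (by norm_num) x)
      (hW'c.intervalIntegrable _ _)]
    simp [hW, hha, hhb]
  have hmono := intervalIntegral.integral_mono_on (μ := volume) hab.le (Continuous.intervalIntegrable (by fun_prop) _ _)
    (Continuous.intervalIntegrable (by fun_prop) _ _) hpt
  rw [intervalIntegral.integral_add (Continuous.intervalIntegrable (by fun_prop) _ _)
      (Continuous.intervalIntegrable (by fun_prop) _ _), hWint, zero_add,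
    intervalIntegral.integral_add (Continuous.intervalIntegrable (by fun_prop) _ _)
      (Continuous.intervalIntegrable (by fun_prop) _ _),
    intervalIntegral.integral_const_mul, intervalIntegral.integral_const_mul,
    intervalIntegral.integral_sub (hfy.intervalIntegrable _ _) (hfy₀.intervalIntegrable _ _)] at hmono
  have hH : H1normSq a b h = (∫ x in a..b, h x ^ 2) + ∫ x in a..b, deriv h x ^ 2 :=
    intervalIntegral.integral_add (Continuous.intervalIntegrable (by fun_prop) _ _)
      (Continuous.intervalIntegrable (by fun_prop) _ _)
  have hfin := hgap _ _ (integral_sq_le_of_left_eq_zero hab hh1 hha)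
  rw [ge_iff_le, hH]
  unfold Phi
  linarith
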